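/- arXiv:2406.04219 — 5 statements merged into one kernel-verified Lean document; each statement's English description precedes it below -/
import Mathlib

section
/- Suppose the reward function class F and all deviation classes Φ_i are complete. If the learner policy σ and expert policy σ_E satisfy regret equivalence, i.e. sup_{f∈F} (R_Φ(σ, f) − R_Φ(σ_E, f)) = 0, then value equivalence holds: sup_{f∈F} max_{i∈[m]} (J_i(π_{σ_E}, f) − J_i(π_σ, f)) = 0; moreover the occupancy measures match exactly, ρ^{π_σ}(s,a) = ρ^{π_{σ_E}}(s,a) for every state–joint-action pair (s,a). -/
open scoped Classical

noncomputable section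

namespace MAIL

/-- A finite Markov Game: horizon `H`, transition kernel `T`, per-agent rewards `r`,
and initial state distribution `ρ₀`.  The agents are indexed by `Fin m`, the state
space is `S`, and agent `i` has action space `A i`; a joint action is an element of
`∀ i, A i`. -/
structure MG (m : ℕ) (S : Type) (A : Fin m → Type) where
  H : ℕ
  T : S → (∀ i, A i) → S → ℝ
  r : Fin m → S → (∀ i, A i) → ℝ
  ρ₀ : S → ℝ

variable {m : ℕ} {S : Type} {A : Fin m → Type} [Fintype S] [∀ i, Fintype (A i)]

/-- The Markov game data is valid: `ρ₀` and each `T s a` are probability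
distributions, and all rewards take values in `[-1, 1]`. -/
def IsMG (G : MG m S A) : Prop :=
  (∀ s, 0 ≤ G.ρ₀ s) ∧ (∑ s, G.ρ₀ s) = 1 ∧
  (∀ s a, (∀ s', 0 ≤ G.T s a s') ∧ (∑ s', G.T s a s') = 1) ∧
  (∀ i s a, |G.r i s a| ≤ 1)

/-- A (mediator or joint) policy is a stochastic map from states to joint actions.
When all agents obediently follow the mediator policy `σ`, the induced joint policy
`π_σ` is `σ` itself. -/
def IsPolicy (π : S → (∀ i, A i) → ℝ) : Prop :=
  ∀ s, (∀ a, 0 ≤ π s a) ∧ (∑ a, π s a) = 1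

/-- Distribution over states at (0-indexed) step `h` under joint policy `π`. -/
def stateDist (G : MG m S A) (π : S → (∀ i, A i) → ℝ) : ℕ → S → ℝ
  | 0 => G.ρ₀
  | h + 1 => fun s' => ∑ s, ∑ a, stateDist G π h s * π s a * G.T s a s'

/-- Expected cumulative reward over horizon `G.H` of joint policy `π` when every
agent's reward function is `f`, i.e. `J(π, f)`. -/
def Jf (G : MG m S A) (π : S → (∀ i, A i) → ℝ) (f : S → (∀ i, A i) → ℝ) : ℝ :=
  ∑ h ∈ Finset.range G.H, ∑ s, ∑ a, stateDist G π h s * π s a * f s a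

/-- Value `J_i(π)` of joint policy `π` for agent `i` under the true rewards. -/
def J (G : MG m S A) (i : Fin m) (π : S → (∀ i, A i) → ℝ) : ℝ :=
  Jf G π (G.r i)

/-- Occupancy measure `ρ^π(s, a) = (1/H) ∑_h Pr_π(s_h = s, a_h = a)`. -/
def occ (G : MG m S A) (π : S → (∀ i, A i) → ℝ) (s : S) (a : ∀ i, A i) : ℝ :=
  (∑ h ∈ Finset.range G.H, stateDist G π h s * π s a) / G.H

/-- Average state visitation distribution `d^π(s) = ∑_a ρ^π(s, a)`. -/
def dAvg (G : MG m S A) (π : S → (∀ i, A i) → ℝ) (s : S) : ℝ :=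
  ∑ a, occ G π s a

/-- The joint policy `π_{σ, φ_i}` obtained from mediator policy `σ` when agent `i`
deviates via `φ : S → A i → A i` (playing `φ s a` when recommended `a` at state `s`)
while all other agents follow their recommendations. -/
def dev (σ : S → (∀ i, A i) → ℝ) (i : Fin m) (φ : S → A i → A i) :
    S → (∀ i, A i) → ℝ :=
  fun s b => ∑ a : ∀ j, A j, if Function.update a i (φ s (a i)) = b then σ s a else 0

/-- Regret `R_Φ(σ, f)` of mediator policy `σ` w.r.t. deviation classes `Φ`, when
`f` is used as every agent's reward function. -/
def regretF (G : MG m S A) (σ : S → (∀ i, A i) → ℝ)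
    (Φ : ∀ i : Fin m, Set (S → A i → A i)) (f : S → (∀ i, A i) → ℝ) : ℝ :=
  ⨆ i : Fin m, ⨆ φ : Φ i, (Jf G (dev σ i φ.1) f - Jf G σ f)

/-- Regret `R_Φ(σ)` of mediator policy `σ` under the true rewards. -/
def regret (G : MG m S A) (σ : S → (∀ i, A i) → ℝ)
    (Φ : ∀ i : Fin m, Set (S → A i → A i)) : ℝ :=
  ⨆ i : Fin m, ⨆ φ : Φ i, (J G i (dev σ i φ.1) - J G i σ)

/-- Value-to-go `V` of joint policy `π` with `k` steps remaining (so the value from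
step `h` in the paper corresponds to `k = H - h` remaining steps), with every
agent's reward given by `f`. -/
def Vgo (G : MG m S A) (f : S → (∀ i, A i) → ℝ) (π : S → (∀ i, A i) → ℝ) :
    ℕ → S → ℝ
  | 0 => fun _ => 0
  | k + 1 => fun s => ∑ a, π s a * (f s a + ∑ s', G.T s a s' * Vgo G f π k s')

/-- Q-value of joint policy `π` with `k` steps remaining. -/
def Qgo (G : MG m S A) (f : S → (∀ i, A i) → ℝ) (π : S → (∀ i, A i) → ℝ)
    (k : ℕ) (s : S) (a : ∀ i, A i) : ℝ :=
  match k with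
  | 0 => 0
  | k + 1 => f s a + ∑ s', G.T s a s' * Vgo G f π k s'

/-- Advantage `A = Q - V` of joint policy `π` with `k` steps remaining. -/
def Adv (G : MG m S A) (f : S → (∀ i, A i) → ℝ) (π : S → (∀ i, A i) → ℝ)
    (k : ℕ) (s : S) (a : ∀ i, A i) : ℝ :=
  Qgo G f π k s a - Vgo G f π k s

/-- `u`-recoverability: the advantage of any expert-plus-single-deviation joint
policy `π_{σ_E, φ_i}` is bounded by `u` at every state, joint action, and step. -/
def Recoverable (G : MG m S A) (Φ : ∀ i : Fin m, Set (S → A i → A i))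
    (σE : S → (∀ i, A i) → ℝ) (u : ℝ) : Prop :=
  ∀ i : Fin m, ∀ φ ∈ Φ i, ∀ k ≤ G.H, ∀ s a, |Adv G (G.r i) (dev σE i φ) k s a| ≤ u

/-- `β`-coverage: the expert's average state distribution puts mass at least `β`
on every state. -/
def Coverage (G : MG m S A) (σE : S → (∀ i, A i) → ℝ) (β : ℝ) : Prop :=
  ∀ s, β ≤ dAvg G σE s

/-- Total variation distance between two finitely supported distributions. -/
def tv {α : Type} [Fintype α] (p q : α → ℝ) : ℝ :=
  (∑ a, |p a - q a|) / 2

lemma stateDist_nonneg {G : MG m S A} (hG : IsMG G) {π : S → (∀ i, A i) → ℝ}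
    (hπ : IsPolicy π) (h : ℕ) (s : S) : 0 ≤ stateDist G π h s := by
  induction h generalizing s with
  | zero => exact hG.1 s
  | succ h ih =>
    exact Finset.sum_nonneg fun s' _ => Finset.sum_nonneg fun a _ =>
      mul_nonneg (mul_nonneg (ih s') ((hπ s').1 a)) ((hG.2.2.1 s' a).1 s)

lemma sum_stateDist {G : MG m S A} (hG : IsMG G) {π : S → (∀ i, A i) → ℝ}
    (hπ : IsPolicy π) (h : ℕ) : ∑ s, stateDist G π h s = 1 := by
  induction h with
  | zero => exact hG.2.1
  | succ h ih =>
    simp only [stateDist]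
    rw [Finset.sum_comm, ← ih]
    refine Finset.sum_congr rfl fun s _ => ?_
    rw [Finset.sum_comm]
    simp only [← Finset.mul_sum, (hG.2.2.1 s _).2, mul_one, (hπ s).2]

/-- Expected number of visits to `(s, a)` under `π`: the unnormalized occupancy measure. -/
def visits (G : MG m S A) (π : S → (∀ i, A i) → ℝ) (s : S) (a : ∀ i, A i) : ℝ :=
  ∑ h ∈ Finset.range G.H, stateDist G π h s * π s a

lemma occ_eq_visits_div (G : MG m S A) (π : S → (∀ i, A i) → ℝ) (s : S) (a : ∀ i, A i) :
    occ G π s a = visits G π s a / G.H := rfl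

lemma visits_nonneg {G : MG m S A} (hG : IsMG G) {π : S → (∀ i, A i) → ℝ}
    (hπ : IsPolicy π) (s : S) (a : ∀ i, A i) : 0 ≤ visits G π s a :=
  Finset.sum_nonneg fun h _ => mul_nonneg (stateDist_nonneg hG hπ h s) ((hπ s).1 a)

lemma sum_visits {G : MG m S A} (hG : IsMG G) {π : S → (∀ i, A i) → ℝ}
    (hπ : IsPolicy π) : ∑ s, ∑ a, visits G π s a = G.H := by
  have hs (s : S) : ∑ a, visits G π s a = ∑ h ∈ Finset.range G.H, stateDist G π h s := by
    simp only [visits]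
    rw [Finset.sum_comm]
    simp only [← Finset.mul_sum, (hπ s).2, mul_one]
  simp only [hs]
  rw [Finset.sum_comm]
  simp [sum_stateDist hG hπ]

lemma Jf_eq_sum_visits (G : MG m S A) (π f : S → (∀ i, A i) → ℝ) :
    Jf G π f = ∑ s, ∑ a, visits G π s a * f s a := by
  simp only [Jf, visits, Finset.sum_mul]
  rw [Finset.sum_comm]
  exact Finset.sum_congr rfl fun s _ => Finset.sum_comm

lemma abs_Jf_le {G : MG m S A} (hG : IsMG G) {π f : S → (∀ i, A i) → ℝ}
    (hπ : IsPolicy π) (hf : ∀ s a, |f s a| ≤ 1) : |Jf G π f| ≤ G.H := by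
  rw [Jf_eq_sum_visits, ← sum_visits hG hπ]
  refine (Finset.abs_sum_le_sum_abs _ _).trans (Finset.sum_le_sum fun s _ => ?_)
  refine (Finset.abs_sum_le_sum_abs _ _).trans (Finset.sum_le_sum fun a _ => ?_)
  rw [abs_mul, abs_of_nonneg (visits_nonneg hG hπ s a)]
  exact mul_le_of_le_one_right (visits_nonneg hG hπ s a) (hf s a)

lemma IsPolicy.dev {σ : S → (∀ i, A i) → ℝ} (hσ : IsPolicy σ) (i : Fin m)
    (φ : S → A i → A i) : IsPolicy (dev σ i φ) := by
  refine fun s => ⟨fun b => Finset.sum_nonneg fun a _ => ?_, ?_⟩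
  · split_ifs
    exacts [(hσ s).1 a, le_rfl]
  · simp only [MAIL.dev]
    rw [Finset.sum_comm]
    simp [(hσ s).2]

lemma dev_eq_zero (σ : S → (∀ i, A i) → ℝ) (i : Fin m) (φ : S → A i → A i) (s : S)
    (b : ∀ i, A i) (hb : ∀ x, φ s x ≠ b i) : dev σ i φ s b = 0 := by
  refine Finset.sum_eq_zero fun a _ => if_neg fun h => hb (a i) ?_
  simpa using congrFun h i

lemma le_regretF (G : MG m S A) (σ : S → (∀ i, A i) → ℝ)
    (Φ : ∀ i : Fin m, Set (S → A i → A i)) (f : S → (∀ i, A i) → ℝ)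
    (i : Fin m) (φ : Φ i) : Jf G (dev σ i φ.1) f - Jf G σ f ≤ regretF G σ Φ f := by
  have : Finite (Φ i) := inferInstance
  exact (le_ciSup (f := fun φ : Φ i => Jf G (dev σ i φ.1) f - Jf G σ f)
      (Set.finite_range _).bddAbove φ).trans
    (le_ciSup (f := fun i => ⨆ φ : Φ i, (Jf G (dev σ i φ.1) f - Jf G σ f))
      (Set.finite_range _).bddAbove i)

lemma regretF_le (G : MG m S A) (σ : S → (∀ i, A i) → ℝ)
    (Φ : ∀ i : Fin m, Set (S → A i → A i)) (f : S → (∀ i, A i) → ℝ) {c : ℝ} (hc : 0 ≤ c)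
    (h : ∀ i, ∀ φ ∈ Φ i, Jf G (dev σ i φ) f - Jf G σ f ≤ c) : regretF G σ Φ f ≤ c :=
  Real.iSup_le (fun i => Real.iSup_le (fun φ => h i φ.1 φ.2) hc) hc

/-- The reward that penalizes the single state–action pair `(s, a)`. -/
def penalty (s : S) (a : ∀ i, A i) : S → (∀ i, A i) → ℝ :=
  fun s' a' => if s' = s ∧ a' = a then -1 else 0

lemma abs_penalty_le (s : S) (a : ∀ i, A i) (s' : S) (a' : ∀ i, A i) :
    |penalty s a s' a'| ≤ 1 := by
  unfold penalty
  split_ifs <;> simp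

lemma Jf_penalty (G : MG m S A) (π : S → (∀ i, A i) → ℝ) (s : S) (a : ∀ i, A i) :
    Jf G π (penalty s a) = -visits G π s a := by
  rw [Jf_eq_sum_visits, Finset.sum_eq_single s, Finset.sum_eq_single a]
  · simp [penalty]
  · intro b _ hb
    simp [penalty, hb]
  · simp
  · intro b _ hb
    simp [penalty, hb]
  · simp

/-- If some agent can avoid its component of `a`, the regret against `penalty s a` is at least
the expected number of visits to `(s, a)`. -/
lemma visits_le_regretF_penalty (G : MG m S A) (σ : S → (∀ i, A i) → ℝ)
    {Φ : ∀ i : Fin m, Set (S → A i → A i)} (hΦ : ∀ i, Φ i = Set.univ)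
    (s : S) (a : ∀ i, A i) {i : Fin m} {b : A i} (hb : b ≠ a i) :
    visits G σ s a ≤ regretF G σ Φ (penalty s a) := by
  have h := le_regretF G σ Φ (penalty s a) i ⟨fun _ _ => b, hΦ i ▸ Set.mem_univ _⟩
  have h0 : visits G (dev σ i fun _ _ => b) s a = 0 := by
    simp [visits, dev_eq_zero σ i (fun _ _ => b) s a fun _ => hb]
  simp only [Jf_penalty, h0] at h
  linarith

lemma regretF_penalty_le {G : MG m S A} (hG : IsMG G) {σ : S → (∀ i, A i) → ℝ}
    (hσ : IsPolicy σ) (Φ : ∀ i : Fin m, Set (S → A i → A i)) (s : S) (a : ∀ i, A i) :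
    regretF G σ Φ (penalty s a) ≤ visits G σ s a := by
  refine regretF_le G σ Φ _ (visits_nonneg hG hσ s a) fun i φ _ => ?_
  rw [Jf_penalty, Jf_penalty]
  linarith [visits_nonneg hG (hσ.dev i φ) s a]

lemma IsPolicy.eq_of_subsingleton [Subsingleton (∀ i, A i)] {σ τ : S → (∀ i, A i) → ℝ}
    (hσ : IsPolicy σ) (hτ : IsPolicy τ) : σ = τ := by
  funext s a
  have h1 := (hσ s).2
  have h2 := (hτ s).2
  rw [Fintype.sum_subsingleton _ a] at h1 h2
  rw [h1, h2]

/-- Regret differences are uniformly bounded over rewards with values in `[-1, 1]`. -/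
lemma bddAbove_regretF_sub (hm : 0 < m) {G : MG m S A} (hG : IsMG G)
    {Φ : ∀ i : Fin m, Set (S → A i → A i)} (hΦ : ∀ i, Φ i = Set.univ)
    {σE σ : S → (∀ i, A i) → ℝ} (hσE : IsPolicy σE) (hσ : IsPolicy σ) :
    BddAbove (Set.range fun f : {f : S → (∀ i, A i) → ℝ // ∀ s a, |f s a| ≤ 1} =>
      regretF G σ Φ f.1 - regretF G σE Φ f.1) := by
  refine ⟨4 * G.H, ?_⟩
  rintro _ ⟨⟨f, hf⟩, rfl⟩
  have hup : regretF G σ Φ f ≤ 2 * G.H := by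
    refine regretF_le G σ Φ f (by positivity) fun i φ _ => ?_
    linarith [(abs_le.1 (abs_Jf_le hG (hσ.dev i φ) hf)).2, (abs_le.1 (abs_Jf_le hG hσ hf)).1]
  have hlow := le_regretF G σE Φ f ⟨0, hm⟩ ⟨fun _ => id, hΦ _ ▸ Set.mem_univ _⟩
  dsimp only at hlow ⊢
  linarith [(abs_le.1 (abs_Jf_le hG (hσE.dev ⟨0, hm⟩ fun _ => id) hf)).1,
    (abs_le.1 (abs_Jf_le hG hσE hf)).2]

lemma visits_eq_of_le {G : MG m S A} (hG : IsMG G) {σE σ : S → (∀ i, A i) → ℝ}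
    (hσE : IsPolicy σE) (hσ : IsPolicy σ)
    (hle : ∀ s a, visits G σ s a ≤ visits G σE s a) : visits G σ = visits G σE := by
  have h := (sum_visits hG hσ).trans (sum_visits hG hσE).symm
  rw [Finset.sum_eq_sum_iff_of_le fun s _ => Finset.sum_le_sum fun a _ => hle s a] at h
  funext s a
  exact (Finset.sum_eq_sum_iff_of_le fun a _ => hle s a).1 (h s (Finset.mem_univ s)) a
    (Finset.mem_univ a)

/-- **Complete classes.** If the reward function class (all functions
`S × A → [-1,1]`) and all deviation classes are complete, and regret equivalence
holds (`sup_f (R_Φ(σ, f) − R_Φ(σ_E, f)) = 0`), then value equivalence holds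
(`sup_f max_i (J_i(π_{σ_E}, f) − J_i(π_σ, f)) = 0`) and moreover the occupancy
measures match exactly. -/
theorem complete_classes_regret_equiv_implies_value_equiv
    {m : ℕ} {S : Type} {A : Fin m → Type} [Fintype S] [∀ i, Fintype (A i)]
    (hm : 0 < m) (G : MG m S A) (hG : IsMG G)
    (Φ : ∀ i : Fin m, Set (S → A i → A i))
    (hΦ : ∀ i, Φ i = (Set.univ : Set (S → A i → A i)))
    (σE σ : S → (∀ i, A i) → ℝ) (hσE : IsPolicy σE) (hσ : IsPolicy σ)
    (hreg : (⨆ f : {f : S → (∀ i, A i) → ℝ // ∀ s a, |f s a| ≤ 1},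
        (regretF G σ Φ f.1 - regretF G σE Φ f.1)) = 0) :
    (⨆ f : {f : S → (∀ i, A i) → ℝ // ∀ s a, |f s a| ≤ 1},
        ⨆ i : Fin m, (Jf G σE f.1 - Jf G σ f.1)) = 0 ∧
    ∀ s a, occ G σ s a = occ G σE s a := by
  have hpt : ∀ f : S → (∀ i, A i) → ℝ, (∀ s a, |f s a| ≤ 1) →
      regretF G σ Φ f ≤ regretF G σE Φ f := fun f hf => by
    have h := le_ciSup (bddAbove_regretF_sub hm hG hΦ hσE hσ) ⟨f, hf⟩
    rw [hreg] at h
    exact sub_nonpos.1 h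
  have hvis : visits G σ = visits G σE := by
    by_cases hA : ∀ i, Subsingleton (A i)
    · rw [hσ.eq_of_subsingleton hσE]
    · push Not at hA
      obtain ⟨i, hi⟩ := hA
      refine visits_eq_of_le hG hσE hσ fun s a => ?_
      obtain ⟨b, hb⟩ := exists_ne (a i)
      exact (visits_le_regretF_penalty G σ hΦ s a hb).trans
        ((hpt _ (abs_penalty_le s a)).trans (regretF_penalty_le hG hσE Φ s a))
  refine ⟨?_, fun s a => by rw [occ_eq_visits_div, occ_eq_visits_div, hvis]⟩
  simp [Jf_eq_sum_visits, hvis]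

end MAIL
end
end

section
/- There exist a finite Markov Game with true reward functions r_i, complete deviation classes Φ, an expert mediator policy σ_E, and a learner policy σ such that regret equivalence holds under the true rewards, i.e. R_Φ(σ) − R_Φ(σ_E) = 0, yet the value gap is nonzero: max_{i∈[m]} (J_i(π_{σ_E}) − J_i(π_σ)) ≠ 0. -/
open scoped Classical

noncomputable section

namespace MAIL

variable {m : ℕ} {S : Type} {A : Fin m → Type} [Fintype S] [∀ i, Fintype (A i)]

/-- The deterministic policy that recommends the joint action `c s` at state `s`. -/
def pointPolicy (c : S → ∀ i, A i) : S → (∀ i, A i) → ℝ :=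
  fun s a => if a = c s then 1 else 0

omit [Fintype S] in
theorem isPolicy_pointPolicy (c : S → ∀ i, A i) : IsPolicy (pointPolicy c) := by
  intro s
  refine ⟨fun a => ?_, by simp [pointPolicy]⟩
  unfold pointPolicy
  split_ifs <;> norm_num

omit [Fintype S] in
theorem dev_pointPolicy (c : S → ∀ i, A i) (i : Fin m) (φ : S → A i → A i) :
    dev (pointPolicy c) i φ =
      pointPolicy fun s => Function.update (c s) i (φ s (c s i)) := by
  funext s b
  unfold dev pointPolicy
  rw [Finset.sum_eq_single (c s)]
  · simp [eq_comm]
  · intro a _ ha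
    simp [ha]
  · simp

theorem Jf_pointPolicy_of_horizon_one (G : MG m S A) (hH : G.H = 1)
    (c : S → ∀ i, A i) (f : S → (∀ i, A i) → ℝ) :
    Jf G (pointPolicy c) f = ∑ s, G.ρ₀ s * f s (c s) := by
  simp [Jf, hH, stateDist, pointPolicy]

/-- The one-shot two-player game in which the first player is rewarded when the second
plays `0`, and the second player is never rewarded. -/
def dictatorGame : MG 2 (Fin 1) (fun _ => Fin 2) where
  H := 1
  T := fun _ _ _ => 1
  r := fun i _ a => if i = 0 ∧ a 1 = 0 then 1 else 0
  ρ₀ := fun _ => 1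

theorem isMG_dictatorGame : IsMG dictatorGame := by
  refine ⟨fun _ => zero_le_one, by simp [dictatorGame],
    fun _ _ => ⟨fun _ => zero_le_one, by simp [dictatorGame]⟩, fun i s a => ?_⟩
  dsimp only [dictatorGame]
  split_ifs <;> simp

theorem J_dictatorGame_pointPolicy (i : Fin 2) (c : Fin 1 → Fin 2 → Fin 2) :
    J dictatorGame i (pointPolicy c) = if i = 0 ∧ c 0 1 = 0 then 1 else 0 := by
  rw [J, Jf_pointPolicy_of_horizon_one _ rfl, Fintype.sum_unique]
  simp [dictatorGame]

theorem regret_dictatorGame_pointPolicy (c : Fin 1 → Fin 2 → Fin 2)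
    (Φ : ∀ _ : Fin 2, Set (Fin 1 → Fin 2 → Fin 2)) :
    regret dictatorGame (pointPolicy c) Φ = 0 := by
  have h (i : Fin 2) (φ : Fin 1 → Fin 2 → Fin 2) :
      J dictatorGame i (dev (pointPolicy c) i φ) - J dictatorGame i (pointPolicy c) = 0 := by
    rw [dev_pointPolicy, J_dictatorGame_pointPolicy, J_dictatorGame_pointPolicy]
    fin_cases i <;> simp
  simp [regret, h]

/-- **Incomplete classes.** There exist a finite Markov Game with true
rewards, complete deviation classes, an expert policy `σ_E`, and a learner policy `σ`
such that regret equivalence holds under the true rewards but the value gap is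
nonzero. -/
theorem regret_equiv_not_value_equiv_incomplete_classes :
    ∃ (m : ℕ) (_ : 0 < m) (nS : ℕ) (nA : Fin m → ℕ)
      (G : MG m (Fin nS) (fun i => Fin (nA i)))
      (Φ : ∀ i : Fin m, Set (Fin nS → Fin (nA i) → Fin (nA i)))
      (σE σ : Fin nS → (∀ i, Fin (nA i)) → ℝ),
      IsMG G ∧ IsPolicy σE ∧ IsPolicy σ ∧
      (∀ i, Φ i = Set.univ) ∧
      regret G σ Φ - regret G σE Φ = 0 ∧
      (⨆ i : Fin m, (J G i σE - J G i σ)) ≠ 0 := by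
  refine ⟨2, two_pos, 1, fun _ => 2, dictatorGame, fun _ => Set.univ,
    pointPolicy fun _ _ => 0, pointPolicy fun _ _ => 1, isMG_dictatorGame,
    isPolicy_pointPolicy _, isPolicy_pointPolicy _, fun _ => rfl, ?_, ?_⟩
  · rw [regret_dictatorGame_pointPolicy, regret_dictatorGame_pointPolicy, sub_zero]
  · refine (lt_of_lt_of_le zero_lt_one
      (le_ciSup_of_le (Set.finite_range _).bddAbove 0 ?_)).ne'
    simp [J_dictatorGame_pointPolicy]

end MAIL
end
end

section
/- There is a universal constant c > 0 such that for every sufficiently large horizon H there exist a finite Markov Game with horizon H (two agents with a common reward function), complete deviation classes Φ, an expert policy σ_E, and a learner policy σ whose occupancy measures match exactly, ρ^{π_σ}(s,a) = ρ^{π_{σ_E}}(s,a) for all (s,a) — so value equivalence holds under every reward function — yet the regret gap satisfies R_Φ(σ) − R_Φ(σ_E) ≥ c·H. -/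
open scoped Classical

noncomputable section

namespace MAIL

variable {m : ℕ} {S : Type} {A : Fin m → Type} [Fintype S] [∀ i, Fintype (A i)]

/-- The policy that plays `f s` at state `s` with probability one. -/
def detPolicy (f : S → ∀ i, A i) : S → (∀ i, A i) → ℝ :=
  fun s a => if a = f s then 1 else 0

lemma isPolicy_detPolicy (f : S → ∀ i, A i) : IsPolicy (detPolicy f) := by
  intro s
  refine ⟨fun a => ?_, by simp [detPolicy]⟩
  unfold detPolicy
  split_ifs <;> norm_num

lemma dev_detPolicy (f : S → ∀ i, A i) (i : Fin m) (φ : S → A i → A i) :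
    dev (detPolicy f) i φ =
      detPolicy fun s => Function.update (f s) i (φ s (f s i)) := by
  funext s b
  unfold dev detPolicy
  rw [Finset.sum_eq_single (f s)]
  · simp [eq_comm]
  · intro a _ ha
    simp [ha]
  · simp

section Deterministic

variable [DecidableEq S] {G : MG m S A} {t : S → (∀ i, A i) → S} {s₀ : S}

lemma stateDist_detPolicy (hT : ∀ s a s', G.T s a s' = if s' = t s a then 1 else 0)
    (hρ : ∀ s, G.ρ₀ s = if s = s₀ then 1 else 0) (f : S → ∀ i, A i) (h : ℕ) (s : S) :
    stateDist G (detPolicy f) h s =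
      if s = (fun s => t s (f s))^[h] s₀ then 1 else 0 := by
  induction h generalizing s with
  | zero => exact hρ s
  | succ h ih =>
    simp only [stateDist, ih, detPolicy, Function.iterate_succ_apply', ite_mul, one_mul,
      zero_mul, mul_ite, mul_one, mul_zero]
    simp [hT]

lemma Jf_detPolicy (hT : ∀ s a s', G.T s a s' = if s' = t s a then 1 else 0)
    (hρ : ∀ s, G.ρ₀ s = if s = s₀ then 1 else 0) (f : S → ∀ i, A i)
    (R : S → (∀ i, A i) → ℝ) :
    Jf G (detPolicy f) R = ∑ h ∈ Finset.range G.H,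
      R ((fun s => t s (f s))^[h] s₀) (f ((fun s => t s (f s))^[h] s₀)) := by
  simp [Jf, stateDist_detPolicy hT hρ, detPolicy]

end Deterministic

/-- Each single deviation gain is a lower bound for the regret. -/
lemma le_regret (G : MG m S A) (σ : S → (∀ i, A i) → ℝ)
    (Φ : ∀ i : Fin m, Set (S → A i → A i)) (i : Fin m) {φ : S → A i → A i}
    (hφ : φ ∈ Φ i) : J G i (dev σ i φ) - J G i σ ≤ regret G σ Φ :=
  (le_ciSup (f := fun φ : Φ i => J G i (dev σ i φ.1) - J G i σ)
    (Set.finite_range _).bddAbove ⟨φ, hφ⟩).trans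
    (le_ciSup (f := fun i => ⨆ φ : Φ i, (J G i (dev σ i φ.1) - J G i σ))
      (Set.finite_range _).bddAbove i)

lemma regret_nonpos {G : MG m S A} {σ : S → (∀ i, A i) → ℝ}
    {Φ : ∀ i : Fin m, Set (S → A i → A i)}
    (h : ∀ i, ∀ φ ∈ Φ i, J G i (dev σ i φ) ≤ J G i σ) : regret G σ Φ ≤ 0 :=
  Real.iSup_le (fun i => Real.iSup_le (fun φ => sub_nonpos.2 (h i φ.1 φ.2)) le_rfl) le_rfl

/-- State `0` is left for the absorbing state `1` exactly when agent `0` plays `1`. -/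
def trapStep (s : Fin 2) (a : Fin 2 → Fin 2) : Fin 2 :=
  if s = 0 ∧ a 0 = 0 then 0 else 1

/-- The common reward: `1` when both agents play `1` in state `1`, and `0` otherwise. -/
def trapReward (s : Fin 2) (a : Fin 2 → Fin 2) : ℝ :=
  if s = 1 ∧ a 0 = 1 ∧ a 1 = 1 then 1 else 0

/-- The common-reward game with dynamics `trapStep` and reward `trapReward`, started in `0`. -/
def trapGame (H : ℕ) : MG 2 (Fin 2) (fun _ => Fin 2) where
  H := H
  T s a s' := if s' = trapStep s a then 1 else 0
  r _ := trapReward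
  ρ₀ s := if s = 0 then 1 else 0

lemma isMG_trapGame (H : ℕ) : IsMG (trapGame H) := by
  refine ⟨fun s => ?_, by simp [trapGame], fun s a => ⟨fun s' => ?_, by simp [trapGame]⟩,
    fun i s a => ?_⟩
  · simp only [trapGame]; split_ifs <;> norm_num
  · simp only [trapGame]; split_ifs <;> norm_num
  · simp only [trapGame, trapReward]; split_ifs <;> norm_num

/-- The value in the trap game of a policy playing `f s` at state `s`. -/
lemma J_trapGame (H : ℕ) (i : Fin 2) (f : Fin 2 → Fin 2 → Fin 2) :
    J (trapGame H) i (detPolicy f) = ∑ h ∈ Finset.range H,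
      trapReward ((fun s => trapStep s (f s))^[h] 0)
        (f ((fun s => trapStep s (f s))^[h] 0)) :=
  Jf_detPolicy (G := trapGame H) (fun _ _ _ => rfl) (fun _ => rfl) f trapReward

lemma iterate_trapStep_of_stay {f : Fin 2 → Fin 2 → Fin 2} (hf : f 0 0 = 0) (h : ℕ) :
    (fun s => trapStep s (f s))^[h] 0 = 0 :=
  Function.iterate_fixed (by simp [trapStep, hf]) h

lemma iterate_trapStep_of_leave {f : Fin 2 → Fin 2 → Fin 2} (hf : f 0 0 = 1) (h : ℕ) :
    (fun s => trapStep s (f s))^[h + 1] 0 = 1 := by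
  rw [Function.iterate_succ_apply]
  simp only [trapStep, hf]
  exact Function.iterate_fixed (by simp) h

lemma J_trapGame_of_stay (H : ℕ) (i : Fin 2) {f : Fin 2 → Fin 2 → Fin 2} (hf : f 0 0 = 0) :
    J (trapGame H) i (detPolicy f) = 0 := by
  simp [J_trapGame, iterate_trapStep_of_stay hf, trapReward]

lemma J_trapGame_of_leave (H : ℕ) (i : Fin 2) (f : Fin 2 → Fin 2 → Fin 2)
    (hf : f 0 0 = 1) (hf' : f 1 = fun _ => 1) :
    J (trapGame (H + 1)) i (detPolicy f) = H := by
  rw [J_trapGame, Finset.sum_range_succ']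
  simp [iterate_trapStep_of_leave hf, trapReward, hf']

/-- No single agent can collect reward when both agents are always told to play `0`. -/
lemma regret_trapGame_zero_nonpos (H : ℕ)
    (Φ : ∀ _ : Fin 2, Set (Fin 2 → Fin 2 → Fin 2)) :
    regret (trapGame H) (detPolicy fun _ _ => 0) Φ ≤ 0 := by
  refine regret_nonpos fun i φ _ => ?_
  rw [J_trapGame_of_stay H i rfl, dev_detPolicy, J_trapGame]
  refine (Finset.sum_eq_zero fun h _ => ?_).le
  fin_cases i <;> simp [trapReward, Function.update]

/-- When both agents are told to match the state, agent `0` gains by always playing `1`. -/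
lemma le_regret_trapGame_state (H : ℕ) :
    (H : ℝ) ≤ regret (trapGame (H + 1)) (detPolicy fun s _ => s) (fun _ => Set.univ) := by
  refine le_trans (le_of_eq ?_) (le_regret _ _ _ 0 (Set.mem_univ fun _ _ => 1))
  rw [J_trapGame_of_stay (H + 1) 0 rfl, dev_detPolicy, J_trapGame_of_leave]
  · simp
  · simp
  · funext j
    fin_cases j <;> simp

/-- **Value equivalence does not imply regret equivalence.** There is a
universal constant `c > 0` such that for every sufficiently large horizon `H` there
exist a two-agent common-reward finite Markov Game with horizon `H`, complete
deviation classes, an expert `σ_E`, and a learner `σ` whose occupancy measures match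
exactly, yet the regret gap is at least `c·H`. -/
theorem value_equivalence_not_regret_equivalence :
    ∃ c : ℝ, 0 < c ∧ ∃ H₀ : ℕ, ∀ H : ℕ, H₀ ≤ H →
      ∃ (nS : ℕ) (nA : Fin 2 → ℕ)
        (G : MG 2 (Fin nS) (fun i => Fin (nA i)))
        (Φ : ∀ i : Fin 2, Set (Fin nS → Fin (nA i) → Fin (nA i)))
        (σE σ : Fin nS → (∀ i, Fin (nA i)) → ℝ),
        IsMG G ∧ G.H = H ∧ G.r 0 = G.r 1 ∧
        IsPolicy σE ∧ IsPolicy σ ∧ (∀ i, Φ i = Set.univ) ∧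
        (∀ s a, occ G σ s a = occ G σE s a) ∧
        c * H ≤ regret G σ Φ - regret G σE Φ := by
  refine ⟨1 / 2, by norm_num, 2, fun H hH => ?_⟩
  obtain ⟨H, rfl⟩ : ∃ k, H = k + 1 := ⟨H - 1, by omega⟩
  refine ⟨2, fun _ => 2, trapGame (H + 1), fun _ => Set.univ, detPolicy fun _ _ => 0,
    detPolicy fun s _ => s, isMG_trapGame _, rfl, rfl, isPolicy_detPolicy _,
    isPolicy_detPolicy _, fun _ => rfl, fun s a => ?_, ?_⟩
  · have hdist (f : Fin 2 → Fin 2 → Fin 2) (hf : f 0 0 = 0) (h : ℕ) (s : Fin 2) :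
        stateDist (trapGame (H + 1)) (detPolicy f) h s = if s = 0 then 1 else 0 := by
      rw [stateDist_detPolicy (t := trapStep) (s₀ := 0) (fun _ _ _ => rfl) (fun _ => rfl),
        iterate_trapStep_of_stay hf]
    unfold occ
    congr 1
    refine Finset.sum_congr rfl fun h _ => ?_
    rw [hdist _ rfl, hdist _ rfl]
    by_cases hs : s = 0
    · subst hs; rfl
    · simp [hs]
  · have hE := regret_trapGame_zero_nonpos (H + 1) fun _ => Set.univ
    have hL := le_regret_trapGame_state H
    have h1 : (1 : ℝ) ≤ H := by exact_mod_cast (by omega : 1 ≤ H)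
    refine le_trans ?_ (sub_le_sub hL hE)
    push_cast
    linarith

end MAIL
end
end

section
/- There is a universal constant c > 0 such that for every sufficiently large horizon H there exist a finite Markov Game with horizon H, complete deviation classes Φ, an expert policy σ_E inducing a 0-approximate correlated equilibrium (R_Φ(σ_E) = 0), and a learner policy σ with zero value gap (max_{i∈[m]} (J_i(π_{σ_E}) − J_i(π_σ)) = 0), yet σ only induces a c·H-approximate correlated equilibrium, i.e. R_Φ(σ) ≥ c·H. -/
open scoped Classical

noncomputable section

namespace MAIL

variable {m : ℕ} {S : Type} {A : Fin m → Type} [Fintype S] [∀ i, Fintype (A i)]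

/-- The deterministic policy playing the joint action `a₀` at every state. -/
def purePolicy {m : ℕ} {S : Type} {A : Fin m → Type} (a₀ : ∀ i, A i) :
    S → (∀ i, A i) → ℝ :=
  fun _ a => if a₀ = a then 1 else 0

theorem isPolicy_purePolicy {m : ℕ} {S : Type} {A : Fin m → Type} [∀ i, Fintype (A i)]
    (a₀ : ∀ i, A i) : IsPolicy (purePolicy (S := S) a₀) := by
  refine fun s => ⟨fun a => ?_, by simp [purePolicy]⟩
  unfold purePolicy
  split_ifs <;> norm_num

/-- Deviating from a deterministic policy of a one-state game yields a deterministic policy. -/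
theorem dev_purePolicy {m : ℕ} {A : Fin m → Type} [∀ i, Fintype (A i)]
    (a₀ : ∀ i, A i) (i : Fin m) (φ : Fin 1 → A i → A i) :
    dev (purePolicy a₀) i φ = purePolicy (Function.update a₀ i (φ 0 (a₀ i))) := by
  funext s b
  obtain rfl : s = 0 := Subsingleton.elim _ _
  unfold dev purePolicy
  rw [Finset.sum_eq_single a₀]
  · simp
  · intro a _ ha
    simp [ha.symm]
  · simp

/-- The game with a single state, in which `r` is played `H` times. -/
def repeatedGame {m : ℕ} {A : Fin m → Type} (H : ℕ) (r : Fin m → (∀ i, A i) → ℝ) :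
    MG m (Fin 1) A where
  H := H
  T := fun _ _ _ => 1
  r := fun i _ a => r i a
  ρ₀ := fun _ => 1

theorem isMG_repeatedGame {m : ℕ} {A : Fin m → Type} [∀ i, Fintype (A i)] (H : ℕ)
    (r : Fin m → (∀ i, A i) → ℝ) (hr : ∀ i a, |r i a| ≤ 1) : IsMG (repeatedGame H r) := by
  refine ⟨fun _ => ?_, ?_, fun _ _ => ⟨fun _ => ?_, ?_⟩, fun i _ a => hr i a⟩ <;>
    simp [repeatedGame]

theorem stateDist_repeatedGame {m : ℕ} {A : Fin m → Type} [∀ i, Fintype (A i)] (H : ℕ)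
    (r : Fin m → (∀ i, A i) → ℝ) (a₀ : ∀ i, A i) (h : ℕ) (s : Fin 1) :
    stateDist (repeatedGame H r) (purePolicy a₀) h s = 1 := by
  induction h generalizing s with
  | zero => rfl
  | succ h ih =>
    simp only [stateDist, ih]
    simp [purePolicy, repeatedGame]

theorem J_repeatedGame {m : ℕ} {A : Fin m → Type} [∀ i, Fintype (A i)] (H : ℕ)
    (r : Fin m → (∀ i, A i) → ℝ) (a₀ : ∀ i, A i) (i : Fin m) :
    J (repeatedGame H r) i (purePolicy a₀) = H * r i a₀ := by
  simp only [J, Jf, stateDist_repeatedGame]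
  simp [purePolicy, repeatedGame]

theorem regret_repeatedGame {m : ℕ} {A : Fin m → Type} [∀ i, Fintype (A i)] (H : ℕ)
    (r : Fin m → (∀ i, A i) → ℝ) (a₀ : ∀ i, A i)
    (Φ : ∀ i : Fin m, Set (Fin 1 → A i → A i)) :
    regret (repeatedGame H r) (purePolicy a₀) Φ =
      ⨆ i : Fin m, ⨆ φ : Φ i,
        ((H : ℝ) * r i (Function.update a₀ i (φ.1 0 (a₀ i))) - H * r i a₀) := by
  simp only [regret, dev_purePolicy, J_repeatedGame]

/-- Bimatrix rewards: the first agent earns `1` exactly at the joint action `(0, 1)`, and the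
second agent never earns anything. -/
def cornerReward (i : Fin 2) (a : Fin 2 → Fin 2) : ℝ :=
  if i = 0 ∧ a 0 = 0 ∧ a 1 = 1 then 1 else 0

/-- **Low value gap does not imply CE.** There is a universal constant
`c > 0` such that for every sufficiently large horizon `H` there exist a finite
Markov Game with horizon `H`, complete deviation classes, an expert policy inducing
an exact correlated equilibrium, and a learner policy with zero value gap, such that
the learner's regret is at least `c·H`. -/
theorem value_gap_does_not_imply_CE :
    ∃ c : ℝ, 0 < c ∧ ∃ H₀ : ℕ, ∀ H : ℕ, H₀ ≤ H →
      ∃ (m : ℕ) (_ : 0 < m) (nS : ℕ) (nA : Fin m → ℕ)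
        (G : MG m (Fin nS) (fun i => Fin (nA i)))
        (Φ : ∀ i : Fin m, Set (Fin nS → Fin (nA i) → Fin (nA i)))
        (σE σ : Fin nS → (∀ i, Fin (nA i)) → ℝ),
        IsMG G ∧ G.H = H ∧
        IsPolicy σE ∧ IsPolicy σ ∧ (∀ i, Φ i = Set.univ) ∧
        regret G σE Φ = 0 ∧
        (⨆ i : Fin m, (J G i σE - J G i σ)) = 0 ∧
        c * H ≤ regret G σ Φ := by
  refine ⟨1, one_pos, 0, fun H _ => ⟨2, two_pos, 1, fun _ => 2, repeatedGame H cornerReward,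
    fun _ => Set.univ, purePolicy (fun _ => 0), purePolicy (fun _ => 1),
    isMG_repeatedGame H _ fun i a => ?_, rfl, isPolicy_purePolicy _, isPolicy_purePolicy _,
    fun _ => rfl, ?_, ?_, ?_⟩⟩
  · unfold cornerReward
    split_ifs <;> norm_num
  · rw [regret_repeatedGame]
    have expert_gain (i : Fin 2) (x : Fin 2) :
        cornerReward i (Function.update (fun _ => 0) i x) = 0 := by
      fin_cases i <;> simp [cornerReward]
    have expert_reward (i : Fin 2) : cornerReward i (fun _ => 0) = 0 := by
      simp [cornerReward]
    simp [expert_gain, expert_reward]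
  · simp [J_repeatedGame, cornerReward]
  · rw [regret_repeatedGame]
    refine le_trans ?_ (le_ciSup (Set.finite_range _).bddAbove (0 : Fin 2))
    refine le_trans ?_ (le_ciSup (Set.finite_range _).bddAbove ⟨fun _ _ => 0, Set.mem_univ _⟩)
    simp [cornerReward]

end MAIL
end
end

section
/- (J-BC value gap upper bound) There is a universal constant C such that in any finite Markov Game, if the learner mediator policy σ satisfies the behavior-cloning guarantee E_{s∼d^{π_{σ_E}}}[ℓ_TV(σ_E(s), σ(s))] ≤ ε with respect to the expert σ_E, then the value gap satisfies max_{i∈[m]} (J_i(π_{σ_E}) − J_i(π_σ)) ≤ C·ε·H². -/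
open scoped Classical

noncomputable section

namespace MAIL

variable {m : ℕ} {S : Type} {A : Fin m → Type} [Fintype S] [∀ i, Fintype (A i)]

/-- `L¹` distance between the expert and learner state distributions at step `h`. -/
def stateGap (G : MG m S A) (σE σ : S → (∀ i, A i) → ℝ) (h : ℕ) : ℝ :=
  ∑ s, |stateDist G σE h s - stateDist G σ h s|

/-- Expected `L¹` distance between the two policies at step `h` under the first one. -/
def policyGap (G : MG m S A) (σE σ : S → (∀ i, A i) → ℝ) (h : ℕ) : ℝ :=
  ∑ s, stateDist G σE h s * ∑ a, |σE s a - σ s a|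

lemma policyGap_nonneg {G : MG m S A} (hG : IsMG G) {σE : S → (∀ i, A i) → ℝ}
    (hE : IsPolicy σE) (σ : S → (∀ i, A i) → ℝ) (h : ℕ) : 0 ≤ policyGap G σE σ h :=
  Finset.sum_nonneg fun s _ => mul_nonneg (stateDist_nonneg hG hE h s)
    (Finset.sum_nonneg fun _ _ => abs_nonneg _)

lemma sum_abs_joint_sub_le {G : MG m S A} (hG : IsMG G) {σE σ : S → (∀ i, A i) → ℝ}
    (hE : IsPolicy σE) (hσ : IsPolicy σ) (h : ℕ) :
    ∑ s, ∑ a, |stateDist G σE h s * σE s a - stateDist G σ h s * σ s a| ≤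
      stateGap G σE σ h + policyGap G σE σ h := by
  rw [stateGap, policyGap, ← Finset.sum_add_distrib]
  refine Finset.sum_le_sum fun s _ => ?_
  rw [← mul_one |stateDist G σE h s - stateDist G σ h s|, ← (hσ s).2, Finset.mul_sum,
    Finset.mul_sum, ← Finset.sum_add_distrib]
  refine Finset.sum_le_sum fun a _ => ?_
  calc |stateDist G σE h s * σE s a - stateDist G σ h s * σ s a|
      = |(stateDist G σE h s - stateDist G σ h s) * σ s a +
          stateDist G σE h s * (σE s a - σ s a)| := by ring_nf
    _ ≤ _ := abs_add_le _ _
    _ = _ := by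
      rw [abs_mul, abs_mul, abs_of_nonneg ((hσ s).1 a),
        abs_of_nonneg (stateDist_nonneg hG hE h s)]

lemma stateGap_succ_le {G : MG m S A} (hG : IsMG G) {σE σ : S → (∀ i, A i) → ℝ}
    (hE : IsPolicy σE) (hσ : IsPolicy σ) (h : ℕ) :
    stateGap G σE σ (h + 1) ≤ stateGap G σE σ h + policyGap G σE σ h := by
  refine le_trans ?_ (sum_abs_joint_sub_le hG hE hσ h)
  calc stateGap G σE σ (h + 1)
      ≤ ∑ s', ∑ s, ∑ a,
          |stateDist G σE h s * σE s a - stateDist G σ h s * σ s a| * G.T s a s' := by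
        refine Finset.sum_le_sum fun s' _ => ?_
        simp only [stateDist, ← Finset.sum_sub_distrib]
        refine (Finset.abs_sum_le_sum_abs _ _).trans (Finset.sum_le_sum fun s _ => ?_)
        refine (Finset.abs_sum_le_sum_abs _ _).trans (Finset.sum_le_sum fun a _ => ?_)
        rw [← sub_mul, abs_mul, abs_of_nonneg ((hG.2.2.1 s a).1 s')]
    _ = ∑ s, ∑ a, |stateDist G σE h s * σE s a - stateDist G σ h s * σ s a| := by
        rw [Finset.sum_comm]
        refine Finset.sum_congr rfl fun s _ => ?_
        rw [Finset.sum_comm]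
        refine Finset.sum_congr rfl fun a _ => ?_
        rw [← Finset.mul_sum, (hG.2.2.1 s a).2, mul_one]

lemma stateGap_le_sum_policyGap {G : MG m S A} (hG : IsMG G) {σE σ : S → (∀ i, A i) → ℝ}
    (hE : IsPolicy σE) (hσ : IsPolicy σ) (h : ℕ) :
    stateGap G σE σ h ≤ ∑ k ∈ Finset.range h, policyGap G σE σ k := by
  induction h with
  | zero => simp [stateGap, stateDist]
  | succ h ih =>
    rw [Finset.sum_range_succ]
    linarith [stateGap_succ_le hG hE hσ h]

lemma Jf_sub_le {G : MG m S A} (hG : IsMG G) {σE σ : S → (∀ i, A i) → ℝ}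
    (hE : IsPolicy σE) (hσ : IsPolicy σ) {f : S → (∀ i, A i) → ℝ} (hf : ∀ s a, |f s a| ≤ 1) :
    Jf G σE f - Jf G σ f ≤ G.H * ∑ k ∈ Finset.range G.H, policyGap G σE σ k := by
  rw [Jf, Jf, ← Finset.sum_sub_distrib, ← nsmul_eq_mul]
  refine (Finset.sum_le_card_nsmul _ _ _ fun h hh => ?_).trans_eq
    (by rw [Finset.card_range])
  have hstep : stateGap G σE σ h + policyGap G σE σ h ≤
      ∑ k ∈ Finset.range G.H, policyGap G σE σ k := by
    refine le_trans ?_ (Finset.sum_le_sum_of_subset_of_nonneg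
      (Finset.range_subset_range.2 (Nat.succ_le_of_lt (Finset.mem_range.1 hh)))
      fun k _ _ => policyGap_nonneg hG hE σ k)
    rw [Finset.sum_range_succ]
    linarith [stateGap_le_sum_policyGap hG hE hσ h]
  refine le_trans ?_ ((sum_abs_joint_sub_le hG hE hσ h).trans hstep)
  rw [← Finset.sum_sub_distrib]
  refine Finset.sum_le_sum fun s _ => ?_
  rw [← Finset.sum_sub_distrib]
  refine Finset.sum_le_sum fun a _ => ?_
  rw [← sub_mul]
  refine (le_abs_self _).trans ?_
  rw [abs_mul]
  exact mul_le_of_le_one_right (abs_nonneg _) (hf s a)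

lemma dAvg_eq (G : MG m S A) {π : S → (∀ i, A i) → ℝ} (hπ : IsPolicy π) (s : S) :
    dAvg G π s = (∑ h ∈ Finset.range G.H, stateDist G π h s) / G.H := by
  simp only [dAvg, occ]
  rw [← Finset.sum_div, Finset.sum_comm]
  simp only [← Finset.mul_sum, (hπ s).2, mul_one]

lemma sum_policyGap_eq (G : MG m S A) {σE : S → (∀ i, A i) → ℝ} (hE : IsPolicy σE)
    (σ : S → (∀ i, A i) → ℝ) :
    ∑ k ∈ Finset.range G.H, policyGap G σE σ k =
      2 * G.H * ∑ s, dAvg G σE s * tv (σE s) (σ s) := by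
  rcases Nat.eq_zero_or_pos G.H with hH | hH
  · simp [hH]
  have hne : (G.H : ℝ) ≠ 0 := by positivity
  simp only [policyGap]
  rw [Finset.sum_comm, Finset.mul_sum]
  refine Finset.sum_congr rfl fun s _ => ?_
  rw [← Finset.sum_mul, dAvg_eq G hE, tv]
  field_simp

/-- **J-BC value gap upper bound.** There is a universal constant `C`
such that in any finite Markov Game, a behavior-cloning guarantee
`E_{s ∼ d^{π_{σ_E}}}[ℓ_TV(σ_E(s), σ(s))] ≤ ε` implies a value gap of at most
`C·ε·H²`. -/
theorem jbc_value_gap_upper_bound :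
    ∃ C : ℝ, 0 < C ∧
      ∀ (m : ℕ) (S : Type) (A : Fin m → Type) [Fintype S] [∀ i, Fintype (A i)]
        (G : MG m S A), IsMG G →
        ∀ (σE σ : S → (∀ i, A i) → ℝ), IsPolicy σE → IsPolicy σ →
        ∀ ε : ℝ, (∑ s, dAvg G σE s * tv (σE s) (σ s)) ≤ ε →
        ∀ i : Fin m, J G i σE - J G i σ ≤ C * ε * (G.H : ℝ) ^ 2 := by
  refine ⟨2, two_pos, fun m S A _ _ G hG σE σ hE hσ ε hε i => ?_⟩
  calc J G i σE - J G i σ ≤ G.H * ∑ k ∈ Finset.range G.H, policyGap G σE σ k :=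
        Jf_sub_le hG hE hσ (hG.2.2.2 i)
    _ = 2 * (∑ s, dAvg G σE s * tv (σE s) (σ s)) * (G.H : ℝ) ^ 2 := by
        rw [sum_policyGap_eq G hE]; ring
    _ ≤ 2 * ε * (G.H : ℝ) ^ 2 := by gcongr

end MAIL
end
end
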